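/- There exist finite simple graphs G and H on 7 vertices each such that the characteristic polynomials of A_G and A_H are equal and the characteristic polynomials of the adjacency matrices of the complements Ḡ and H̄ are equal (G and H have the same generalized spectrum), yet w⁽⁰⁾(G) ≠ w⁽⁰⁾(H) and WM(G) ≠ WM(H). (That is, the generalized spectrum determines neither the eigenvalue–angle invariant nor the walk matrix.) -/

import Mathlib

/-- The adjacency matrix over `ℝ` of a graph (with classical decidability). -/
noncomputable def adjMatR {V : Type*} [Fintype V] [DecidableEq V] (G : SimpleGraph V) : Matrix V V ℝ :=
  letI := Classical.decRel G.Adj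
  G.adjMatrix ℝ

/-- The walk count `w_k(x,y)`: the `(x,y)` entry of the `k`-th power of the
adjacency matrix, i.e. the number of `k`-walks from `x` to `y`. -/
noncomputable def walkFunC {V : Type*} [Fintype V] [DecidableEq V] (G : SimpleGraph V) (x y : V) : ℕ → ℕ :=
  letI := Classical.decRel G.Adj
  fun k => (G.adjMatrix ℕ ^ k) x y

/-- `w⁽⁰⁾(G)`: the multiset, over vertices `x`, of the closed walk-count functions
`k ↦ w_k(x,x)`. -/
noncomputable def wZeroC {V : Type*} [Fintype V] [DecidableEq V] (G : SimpleGraph V) : Multiset (ℕ → ℕ) :=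
  (Finset.univ : Finset V).val.map fun x => walkFunC G x x

/-- `WM(G)`: the multiset, over vertices `x`, of the walk-matrix rows
`k ↦ Σ_y w_k(x,y)`. -/
noncomputable def WMC {V : Type*} [Fintype V] [DecidableEq V] (G : SimpleGraph V) : Multiset (ℕ → ℕ) :=
  (Finset.univ : Finset V).val.map fun x => fun k => ∑ y, walkFunC G x y k

/-- Adjacency of the spider: centre `0`, middle vertices `4,5,6`, leaves `1,2,3`. -/
def spiderList : List (Fin 7 × Fin 7) := [(4,0),(4,1),(5,0),(5,2),(6,0),(6,3)]

/-- Adjacency of a hexagon together with the isolated vertex `0`. -/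
def hexList : List (Fin 7 × Fin 7) := [(4,2),(4,3),(5,1),(5,3),(6,1),(6,2)]

/-- The spider graph. -/
def spiderG : SimpleGraph (Fin 7) where
  Adj x y := (x, y) ∈ spiderList ∨ (y, x) ∈ spiderList
  symm := ⟨fun _ _ h => h.symm⟩
  loopless := ⟨by decide⟩

/-- The hexagon plus an isolated vertex. -/
def hexG : SimpleGraph (Fin 7) where
  Adj x y := (x, y) ∈ hexList ∨ (y, x) ∈ hexList
  symm := ⟨fun _ _ h => h.symm⟩
  loopless := ⟨by decide⟩

instance : DecidableRel spiderG.Adj := fun x y =>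
  inferInstanceAs (Decidable ((x, y) ∈ spiderList ∨ (y, x) ∈ spiderList))

instance : DecidableRel hexG.Adj := fun x y =>
  inferInstanceAs (Decidable ((x, y) ∈ hexList ∨ (y, x) ∈ hexList))

/-- Twice the Godsil–McKay switching matrix for the set `{0,1,2,3}`. -/
def switchP : Matrix (Fin 7) (Fin 7) ℤ := fun i j =>
  if i < 4 ∧ j < 4 then (if i = j then -1 else 1) else (if i = j then 2 else 0)

theorem adjMatR_eq_map (G : SimpleGraph (Fin 7)) [DecidableRel G.Adj] :
    adjMatR G = (G.adjMatrix ℤ).map (Int.castRingHom ℝ) := by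
  ext i j
  by_cases h : G.Adj i j <;> simp [adjMatR, SimpleGraph.adjMatrix_apply, h]

theorem charpoly_eq_of_switch (G H : SimpleGraph (Fin 7)) [DecidableRel G.Adj]
    [DecidableRel H.Adj] (P : Matrix (Fin 7) (Fin 7) ℤ)
    (hP : P * P = (4 : ℤ) • (1 : Matrix (Fin 7) (Fin 7) ℤ))
    (h : P * H.adjMatrix ℤ = G.adjMatrix ℤ * P) :
    (adjMatR G).charpoly = (adjMatR H).charpoly := by
  rw [adjMatR_eq_map G, adjMatR_eq_map H]
  have hP' := congrArg (fun M => M.map (Int.castRingHom ℝ)) hP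
  have h' := congrArg (fun M => M.map (Int.castRingHom ℝ)) h
  simp only [Matrix.map_mul] at hP' h'
  generalize (G.adjMatrix ℤ).map (Int.castRingHom ℝ) = A at *
  generalize (H.adjMatrix ℤ).map (Int.castRingHom ℝ) = B at *
  generalize P.map (Int.castRingHom ℝ) = Q at *
  have hQ : Q * Q = (4 : ℝ) • (1 : Matrix (Fin 7) (Fin 7) ℝ) := by
    rw [hP']
    ext i j
    by_cases hij : i = j <;> simp only [Matrix.map_apply, Matrix.smul_apply, Matrix.one_apply, hij] <;> simp
  have hA : A = ((1 / 4 : ℝ) • (Q * B)) * Q := by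
    rw [h', Matrix.smul_mul, Matrix.mul_assoc, hQ]
    simp [smul_smul]
  have hB : B = Q * ((1 / 4 : ℝ) • (Q * B)) := by
    rw [Matrix.mul_smul, ← Matrix.mul_assoc, hQ]
    simp [smul_smul]
  calc A.charpoly = (((1 / 4 : ℝ) • (Q * B)) * Q).charpoly := by rw [← hA]
    _ = (Q * ((1 / 4 : ℝ) • (Q * B))).charpoly := Matrix.charpoly_mul_comm _ _
    _ = B.charpoly := by rw [← hB]

theorem walkFunC_eq (G : SimpleGraph (Fin 7)) [inst : DecidableRel G.Adj] (x y : Fin 7) (k : ℕ) :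
    walkFunC G x y k = (G.adjMatrix ℕ ^ k) x y := by
  unfold walkFunC
  congr!

theorem wZeroC_map (G : SimpleGraph (Fin 7)) [DecidableRel G.Adj] :
    (wZeroC G).map (fun f => f 2) =
      (Finset.univ : Finset (Fin 7)).val.map fun x => (G.adjMatrix ℕ * G.adjMatrix ℕ) x x := by
  simp only [wZeroC, Multiset.map_map, Function.comp_def, walkFunC_eq, pow_two]

theorem WMC_map (G : SimpleGraph (Fin 7)) [DecidableRel G.Adj] :
    (WMC G).map (fun f => f 1) =
      (Finset.univ : Finset (Fin 7)).val.map fun x => ∑ y, (G.adjMatrix ℕ) x y := by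
  simp only [WMC, Multiset.map_map, Function.comp_def, walkFunC_eq, pow_one]

/-- There exist graphs `G`, `H` on 7 vertices with the same
generalized spectrum (cospectral with cospectral complements) such that
`w⁽⁰⁾(G) ≠ w⁽⁰⁾(H)` and `WM(G) ≠ WM(H)`: the generalized spectrum determines
neither the eigenvalue–angle invariant nor the walk matrix. -/
theorem exists_genspec_eq_wZero_WM_ne :
    ∃ (G H : SimpleGraph (Fin 7)),
      (adjMatR G).charpoly = (adjMatR H).charpoly ∧
      (adjMatR Gᶜ).charpoly = (adjMatR Hᶜ).charpoly ∧
      wZeroC G ≠ wZeroC H ∧ WMC G ≠ WMC H := by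
  refine ⟨spiderG, hexG, ?_, ?_, ?_, ?_⟩
  · exact charpoly_eq_of_switch _ _ switchP (by decide +kernel) (by decide +kernel)
  · exact charpoly_eq_of_switch _ _ switchP (by decide +kernel) (by decide +kernel)
  · intro h
    have h2 := congrArg (Multiset.map (fun f : ℕ → ℕ => f 2)) h
    rw [wZeroC_map, wZeroC_map] at h2
    revert h2
    decide +kernel
  · intro h
    have h2 := congrArg (Multiset.map (fun f : ℕ → ℕ => f 1)) h
    rw [WMC_map, WMC_map] at h2
    revert h2
    decide +kernel
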